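/- Let 𝒬 be a UCQ, ℛ a finite set of disjunctive existential rules and F a fact base. Then F, ℛ ⊨ 𝒬 if and only if there exists a finite derivation tree 𝒯 of (F, ℛ) such that res(𝒯) ⊨ 𝒬; equivalently, F, ℛ ⊨ 𝒬 if and only if there exists a derivation 𝒟 of ({F}, ℛ) whose result ℱ_k satisfies ℱ_k ⊨ 𝒬. -/

import Mathlib

/-! ## Basic syntax: terms, atoms, substitutions -/

/-- A term over variables `V` and constants `C`. -/
inductive FOTerm (V C : Type) where
  | var (v : V)
  | const (c : C)
deriving DecidableEq

/-- An atom `p(t_1,...,t_n)`. -/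
structure FOAtom (P V C : Type) where
  pred : P
  args : List (FOTerm V C)
deriving DecidableEq

/-- A substitution of variables by terms. -/
abbrev FOSubst (V C : Type) := V → FOTerm V C

variable {P V C : Type}

def FOTerm.applySub (u : FOSubst V C) : FOTerm V C → FOTerm V C
  | FOTerm.var v => u v
  | FOTerm.const c => FOTerm.const c

def FOAtom.applySub (u : FOSubst V C) (a : FOAtom P V C) : FOAtom P V C :=
  ⟨a.pred, a.args.map (FOTerm.applySub u)⟩

def applySubFS [DecidableEq P] [DecidableEq V] [DecidableEq C]
    (u : FOSubst V C) (S : Finset (FOAtom P V C)) : Finset (FOAtom P V C) :=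
  S.image (FOAtom.applySub u)

def FOTerm.varsOf [DecidableEq V] : FOTerm V C → Finset V
  | FOTerm.var v => {v}
  | FOTerm.const _ => ∅

def FOAtom.varsOf [DecidableEq V] (a : FOAtom P V C) : Finset V :=
  a.args.foldr (fun t acc => t.varsOf ∪ acc) ∅

/-- Variables occurring in a finite set of atoms. -/
def varsFS [DecidableEq V] (S : Finset (FOAtom P V C)) : Finset V :=
  S.sup FOAtom.varsOf

/-- Terms occurring in a finite set of atoms. -/
def termsFS [DecidableEq V] [DecidableEq C] (S : Finset (FOAtom P V C)) :
    Finset (FOTerm V C) :=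
  S.sup (fun a => a.args.toFinset)

/-- `h` is a homomorphism from the atom set `S₁` to the atom set `S₂`. -/
def IsHom (h : FOSubst V C) (S₁ S₂ : Finset (FOAtom P V C)) : Prop :=
  ∀ a ∈ S₁, a.applySub h ∈ S₂

/-- `S₂ ⊨ S₁` for atom sets viewed as existentially closed conjunctions:
there is a homomorphism from `S₁` to `S₂`. -/
def EntailsFS (S₂ S₁ : Finset (FOAtom P V C)) : Prop :=
  ∃ h : FOSubst V C, IsHom h S₁ S₂

/-! ## Disjunctive existential rules, triggers, chase step α -/

/-- A disjunctive existential rule `B → H₁ ∨ ... ∨ Hₙ`. -/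
structure DisjRule (P V C : Type) where
  body : Finset (FOAtom P V C)
  heads : List (Finset (FOAtom P V C))

/-- Well-formedness: non-empty body, at least one head disjunct, non-empty disjuncts. -/
def DisjRule.WF (R : DisjRule P V C) : Prop :=
  R.body.Nonempty ∧ R.heads ≠ [] ∧ ∀ H ∈ R.heads, H.Nonempty

/-- All variables of a rule. -/
def DisjRule.vars [DecidableEq V] (R : DisjRule P V C) : Finset V :=
  varsFS R.body ∪ R.heads.foldr (fun H acc => varsFS H ∪ acc) ∅

/-- A trigger `(R, h)` on `F`: `h` is a homomorphism from the body of `R` to `F`. -/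
def IsTrigger (R : DisjRule P V C) (h : FOSubst V C) (F : Finset (FOAtom P V C)) : Prop :=
  IsHom h R.body F

/-- `h'` is a safe extension of `h` for the head disjunct `H` of rule `R` w.r.t. the
fact base `F`: it agrees with `h` outside the existential variables of `H` and renames
the existential variables of `H` injectively to fresh variables. -/
def IsSafeExt [DecidableEq V] (F : Finset (FOAtom P V C)) (R : DisjRule P V C)
    (H : Finset (FOAtom P V C)) (h h' : FOSubst V C) : Prop :=
  (∀ v : V, v ∉ varsFS H \ varsFS R.body → h' v = h v) ∧
  (∀ v ∈ varsFS H \ varsFS R.body, ∃ w : V, h' v = FOTerm.var w ∧ w ∉ varsFS F) ∧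
  (∀ v ∈ varsFS H \ varsFS R.body, ∀ v' ∈ varsFS H \ varsFS R.body,
      h' v = h' v' → v = v')

/-- `L` is a result of the application `α_∨(F, R, h)` of the trigger `(R, h)` on `F`:
its `i`-th element is `F ∪ h^{safeᵢ}(Hᵢ)`. -/
def IsAlpha [DecidableEq P] [DecidableEq V] [DecidableEq C]
    (F : Finset (FOAtom P V C)) (R : DisjRule P V C) (h : FOSubst V C)
    (L : List (Finset (FOAtom P V C))) : Prop :=
  L.length = R.heads.length ∧
  ∀ (i : ℕ) (hi : i < L.length) (hi' : i < R.heads.length),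
    ∃ h' : FOSubst V C, IsSafeExt F R (R.heads.get ⟨i, hi'⟩) h h' ∧
      L.get ⟨i, hi⟩ = F ∪ applySubFS h' (R.heads.get ⟨i, hi'⟩)

/-! ## Partitions of terms (as equivalence relations), piece-unifiers -/

/-- A relation on terms, representing a partition of a set of terms (two terms are
related iff they belong to the same class). -/
abbrev TRel (V C : Type) := FOTerm V C → FOTerm V C → Prop

/-- Admissibility of a partition: no class contains two distinct constants. -/
def RelAdmissible (r : TRel V C) : Prop :=
  ∀ c c' : C, r (FOTerm.const c) (FOTerm.const c') → c = c'

/-- `u` is a substitution associated with the partition represented by `r`: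
it is constant on classes, maps each term to a member of its class (the selected term),
and gives priority to constants. -/
def IsAssocSub (r : TRel V C) (u : FOSubst V C) : Prop :=
  (∀ s t, r s t → s.applySub u = t.applySub u) ∧
  (∀ t, r t (t.applySub u)) ∧
  (∀ (v : V) (c : C), r (FOTerm.var v) (FOTerm.const c) → u v = FOTerm.const c)

/-- The data of a piece-unifier `(Q', H', P_u)`. -/
structure PieceUnif (P V C : Type) where
  Q' : Finset (FOAtom P V C)
  H' : Finset (FOAtom P V C)
  rel : TRel V C

/-- `μ` is a piece-unifier of the CQ `Q` with the conjunctive rule `B → H`. -/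
def IsPieceUnifier [DecidableEq P] [DecidableEq V] [DecidableEq C]
    (Q : Finset (FOAtom P V C)) (B H : Finset (FOAtom P V C))
    (μ : PieceUnif P V C) : Prop :=
  μ.Q'.Nonempty ∧ μ.Q' ⊆ Q ∧ μ.H' ⊆ H ∧
  Equivalence μ.rel ∧
  -- the partition is on the terms of Q' and H' (all other classes are singletons)
  (∀ s t, μ.rel s t → s = t ∨
      (s ∈ termsFS μ.Q' ∪ termsFS μ.H' ∧ t ∈ termsFS μ.Q' ∪ termsFS μ.H')) ∧
  RelAdmissible μ.rel ∧
  -- classes containing an existential variable of H' contain otherwise only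
  -- non-separating variables of Q'
  (∀ z ∈ varsFS μ.H' \ varsFS B, ∀ t, μ.rel (FOTerm.var z) t → t = FOTerm.var z ∨
      ∃ v : V, t = FOTerm.var v ∧ FOTerm.var v ∈ termsFS μ.Q' ∧ v ∉ varsFS (Q \ μ.Q')) ∧
  -- unification condition
  (∀ u : FOSubst V C, IsAssocSub μ.rel u → applySubFS u μ.Q' = applySubFS u μ.H')

/-- The join of a list of partitions (represented as relations): the equivalence
relation generated by their union. -/
def joinRel (rs : List (TRel V C)) : TRel V C :=
  Relation.EqvGen (fun s t => ∃ r ∈ rs, r s t)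

/-- The data of a disjunctive piece-unifier: the safe copies `Q₁, ..., Qₙ` together
with the conjunctive piece-unifiers `μ₁, ..., μₙ`. -/
structure DisjPieceUnif (P V C : Type) where
  Qs : List (Finset (FOAtom P V C))
  mus : List (PieceUnif P V C)

/-- The join of the partitions of a disjunctive piece-unifier. -/
def DisjPieceUnif.rel (μ : DisjPieceUnif P V C) : TRel V C :=
  joinRel (μ.mus.map PieceUnif.rel)

/-- `Qc` is a safe copy of `Q` (bijective renaming of its variables). -/
def IsSafeCopy [DecidableEq P] [DecidableEq V] [DecidableEq C]
    (Q Qc : Finset (FOAtom P V C)) : Prop :=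
  ∃ ρ : V → V, Function.Injective ρ ∧
    Qc = Q.image (FOAtom.applySub (fun v => FOTerm.var (ρ v)))

/-- `μ` is a disjunctive piece-unifier of the UCQ `𝒬` with the disjunctive rule `R`. -/
def IsDisjPieceUnifier [DecidableEq P] [DecidableEq V] [DecidableEq C]
    (𝒬 : Set (Finset (FOAtom P V C))) (R : DisjRule P V C)
    (μ : DisjPieceUnif P V C) : Prop :=
  μ.Qs.length = R.heads.length ∧ μ.mus.length = R.heads.length ∧
  -- each Qᵢ is a safe copy of a CQ of 𝒬, with variables disjoint from the rule
  -- and from the other copies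
  (∀ (i : ℕ) (hi : i < μ.Qs.length), ∃ Q ∈ 𝒬, IsSafeCopy Q (μ.Qs.get ⟨i, hi⟩)) ∧
  (∀ (i : ℕ) (hi : i < μ.Qs.length), Disjoint (varsFS (μ.Qs.get ⟨i, hi⟩)) R.vars) ∧
  (∀ (i j : ℕ) (hi : i < μ.Qs.length) (hj : j < μ.Qs.length), i ≠ j →
      Disjoint (varsFS (μ.Qs.get ⟨i, hi⟩)) (varsFS (μ.Qs.get ⟨j, hj⟩))) ∧
  -- each μᵢ is a piece-unifier of Qᵢ with B → Hᵢ
  (∀ (i : ℕ) (hi : i < R.heads.length) (hi1 : i < μ.Qs.length) (hi2 : i < μ.mus.length),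
      IsPieceUnifier (μ.Qs.get ⟨i, hi1⟩) R.body (R.heads.get ⟨i, hi⟩)
        (μ.mus.get ⟨i, hi2⟩)) ∧
  -- the join of the partitions is admissible
  RelAdmissible μ.rel

/-- `β_∨(𝒬, R, μ) = u(B) ∪ ⋃ᵢ u(Qᵢ ∖ Qᵢ')`, for `u` a substitution associated with
the join of the partitions of `μ`. -/
def betaRw [DecidableEq P] [DecidableEq V] [DecidableEq C]
    (R : DisjRule P V C) (μ : DisjPieceUnif P V C) (u : FOSubst V C) :
    Finset (FOAtom P V C) :=
  applySubFS u R.body ∪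
    (List.zipWith (fun Qi m => applySubFS u (Qi \ PieceUnif.Q' m)) μ.Qs μ.mus).foldr
      (· ∪ ·) ∅

/-! ## Semantics -/

/-- A first-order interpretation (with non-empty domain). -/
structure Interp (P V C : Type) where
  dom : Type
  nonempty : Nonempty dom
  rel : P → List dom → Prop
  cst : C → dom

def Interp.evalT (I : Interp P V C) (a : V → I.dom) : FOTerm V C → I.dom
  | FOTerm.var v => a v
  | FOTerm.const c => I.cst c

def Interp.satAtom (I : Interp P V C) (a : V → I.dom) (atm : FOAtom P V C) : Prop :=
  I.rel atm.pred (atm.args.map (I.evalT a))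

def Interp.satFS (I : Interp P V C) (a : V → I.dom) (S : Finset (FOAtom P V C)) : Prop :=
  ∀ atm ∈ S, I.satAtom a atm

/-- `I` is a model of the atom set `S` viewed as an existentially closed conjunction. -/
def Interp.modelsFB [DecidableEq V] (I : Interp P V C) (S : Finset (FOAtom P V C)) : Prop :=
  ∃ a : V → I.dom, I.satFS a S

/-- `I` satisfies the disjunctive existential rule `R`. -/
def Interp.satRule [DecidableEq V] (I : Interp P V C) (R : DisjRule P V C) : Prop :=
  ∀ a : V → I.dom, I.satFS a R.body →
    ∃ H ∈ R.heads, ∃ a' : V → I.dom,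
      (∀ v ∈ varsFS R.body, a' v = a v) ∧ I.satFS a' H

/-- First-order entailment `F, ℛ ⊨ 𝒬` of a UCQ from a fact base and a set of
disjunctive existential rules. -/
def SemEntails [DecidableEq V] (F : Finset (FOAtom P V C)) (ℛ : Set (DisjRule P V C))
    (𝒬 : Set (Finset (FOAtom P V C))) : Prop :=
  ∀ I : Interp P V C, I.modelsFB F → (∀ R ∈ ℛ, I.satRule R) →
    ∃ Q ∈ 𝒬, I.modelsFB Q

/-! ## Piece-rewriting -/

/-- `IsPieceRewriting ℛ 𝒬 𝒬'` holds when the UCQ `𝒬'` is obtained from the UCQ `𝒬`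
by a finite sequence of one-step piece-rewritings with rules of `ℛ`. -/
inductive IsPieceRewriting [DecidableEq P] [DecidableEq V] [DecidableEq C]
    (ℛ : Set (DisjRule P V C)) :
    Finset (Finset (FOAtom P V C)) → Finset (Finset (FOAtom P V C)) → Prop
  | refl (𝒬 : Finset (Finset (FOAtom P V C))) : IsPieceRewriting ℛ 𝒬 𝒬
  | step (𝒬 𝒬' : Finset (Finset (FOAtom P V C))) (R : DisjRule P V C)
      (μ : DisjPieceUnif P V C) (u : FOSubst V C) :
      IsPieceRewriting ℛ 𝒬 𝒬' → R ∈ ℛ →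
      IsDisjPieceUnifier (↑𝒬' : Set (Finset (FOAtom P V C))) R μ →
      IsAssocSub μ.rel u →
      IsPieceRewriting ℛ 𝒬 (insert (betaRw R μ u) 𝒬')

/-- A (possibly infinite) derivation tree of `(F₀, ℛ)`: a rooted labeled tree whose
root is labeled `F₀` and such that the labels of the children of any inner vertex are
exactly the result of applying a trigger of a rule of `ℛ` to the vertex's label. -/
structure DerivTree {P V C : Type} [DecidableEq P] [DecidableEq V] [DecidableEq C]
    (ℛ : Set (DisjRule P V C)) (F₀ : Finset (FOAtom P V C)) where
  Vtx : Type
  root : Vtx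
  label : Vtx → Finset (FOAtom P V C)
  children : Vtx → List Vtx
  root_label : label root = F₀
  step : ∀ v : Vtx, children v ≠ [] →
    ∃ R ∈ ℛ, ∃ h : FOSubst V C, IsTrigger R h (label v) ∧
      IsAlpha (label v) R h ((children v).map label)

/-- A branch of a derivation tree: a maximal path from the root (encoded as a
sequence of vertices which stutters once a leaf is reached). -/
def DerivTree.IsBranch {P V C : Type} [DecidableEq P] [DecidableEq V] [DecidableEq C]
    {ℛ : Set (DisjRule P V C)} {F₀ : Finset (FOAtom P V C)}
    (T : DerivTree ℛ F₀) (b : ℕ → T.Vtx) : Prop :=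
  b 0 = T.root ∧
  ∀ k : ℕ, b (k + 1) ∈ T.children (b k) ∨ (T.children (b k) = [] ∧ b (k + 1) = b k)

/-- A (possibly infinite) set of facts `S` entails the CQ `Q`. -/
def SetEntailsCQ {P V C : Type} (S : Set (FOAtom P V C)) (Q : Finset (FOAtom P V C)) :
    Prop :=
  ∃ h : FOSubst V C, ∀ a ∈ Q, a.applySub h ∈ S

/-- `res(𝒯) ⊨ 𝒬`: every element of the result of the derivation tree `𝒯` (the union
of the labels along a branch, for each branch) entails some CQ of `𝒬`. -/
def DerivTree.ResEntails {P V C : Type} [DecidableEq P] [DecidableEq V] [DecidableEq C]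
    {ℛ : Set (DisjRule P V C)} {F₀ : Finset (FOAtom P V C)}
    (T : DerivTree ℛ F₀) (𝒬 : Set (Finset (FOAtom P V C))) : Prop :=
  ∀ b : ℕ → T.Vtx, T.IsBranch b →
    ∃ Q ∈ 𝒬, SetEntailsCQ (⋃ k : ℕ, (↑(T.label (b k)) : Set (FOAtom P V C))) Q

/-- The trigger `(R, h)` is satisfied by `F`: some extension of `h` maps some head
disjunct of `R` into `F`. -/
def TriggerSatisfied {P V C : Type} [DecidableEq V]
    (R : DisjRule P V C) (h : FOSubst V C) (F : Finset (FOAtom P V C)) : Prop :=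
  ∃ H ∈ R.heads, ∃ h' : FOSubst V C,
    (∀ v ∈ varsFS R.body, h' v = h v) ∧ IsHom h' H F

/-- Fairness: along every branch, every trigger on a vertex label is satisfied at
some vertex of the branch. A chase tree is a fair derivation tree. -/
def DerivTree.Fair {P V C : Type} [DecidableEq P] [DecidableEq V] [DecidableEq C]
    {ℛ : Set (DisjRule P V C)} {F₀ : Finset (FOAtom P V C)}
    (T : DerivTree ℛ F₀) : Prop :=
  ∀ b : ℕ → T.Vtx, T.IsBranch b → ∀ k : ℕ, ∀ R ∈ ℛ, ∀ h : FOSubst V C,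
    IsTrigger R h (T.label (b k)) →
      ∃ k' : ℕ, TriggerSatisfied R h (T.label (b k'))

/-- A derivation of `({F}, ℛ)`: a finite sequence of sets of fact bases, each obtained
from the previous one by replacing some fact base by the result of applying a trigger
to it. -/
inductive IsDerivation {P V C : Type} [DecidableEq P] [DecidableEq V] [DecidableEq C]
    (ℛ : Set (DisjRule P V C)) :
    Finset (Finset (FOAtom P V C)) → Finset (Finset (FOAtom P V C)) → Prop
  | refl (ℱ : Finset (Finset (FOAtom P V C))) : IsDerivation ℛ ℱ ℱ
  | step (ℱ₀ ℱ : Finset (Finset (FOAtom P V C))) (F : Finset (FOAtom P V C))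
      (R : DisjRule P V C) (h : FOSubst V C) (L : List (Finset (FOAtom P V C))) :
      IsDerivation ℛ ℱ₀ ℱ → F ∈ ℱ → R ∈ ℛ → IsTrigger R h F → IsAlpha F R h L →
      IsDerivation ℛ ℱ₀ ((ℱ.erase F) ∪ L.toFinset)

/-! ## Variables, evaluation and substitution -/

section Basic

lemma Interp.evalT_applySub (I : Interp P V C) (a : V → I.dom) (h : FOSubst V C)
    (t : FOTerm V C) :
    I.evalT a (t.applySub h) = I.evalT (fun v => I.evalT a (h v)) t := by
  cases t <;> rfl

lemma Interp.satAtom_applySub (I : Interp P V C) (a : V → I.dom) (h : FOSubst V C)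
    (A : FOAtom P V C) :
    I.satAtom a (A.applySub h) ↔ I.satAtom (fun v => I.evalT a (h v)) A := by
  simp only [Interp.satAtom, FOAtom.applySub, List.map_map]
  rw [show I.evalT a ∘ FOTerm.applySub h = I.evalT (fun v => I.evalT a (h v)) from
    funext fun t => I.evalT_applySub a h t]

lemma Interp.satFS_of_isHom (I : Interp P V C) {a : V → I.dom} {h : FOSubst V C}
    {S G : Finset (FOAtom P V C)} (hh : IsHom h S G) (hG : I.satFS a G) :
    I.satFS (fun v => I.evalT a (h v)) S :=
  fun A hA => (I.satAtom_applySub a h A).1 (hG _ (hh A hA))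

lemma IsHom.mono {h : FOSubst V C} {S G G' : Finset (FOAtom P V C)}
    (hh : IsHom h S G) (hG : G ⊆ G') : IsHom h S G' :=
  fun A hA => hG (hh A hA)

/-- A homomorphism from a finite set of atoms to the union of an increasing sequence of fact
bases is a homomorphism to one of them. -/
lemma exists_isHom_of_iUnion {G : ℕ → Finset (FOAtom P V C)} (hG : Monotone G)
    {h : FOSubst V C} {S : Finset (FOAtom P V C)}
    (hh : ∀ A ∈ S, ∃ n, A.applySub h ∈ G n) : ∃ n, IsHom h S (G n) := by
  choose! f hf using hh
  exact ⟨S.sup f, fun A hA => hG (Finset.le_sup hA) (hf A hA)⟩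

variable [DecidableEq V]

lemma FOTerm.mem_varsOf {t : FOTerm V C} {v : V} : v ∈ t.varsOf ↔ t = FOTerm.var v := by
  cases t with
  | var w => simp [FOTerm.varsOf, eq_comm]
  | const c => simp [FOTerm.varsOf]

lemma FOAtom.mem_varsOf {a : FOAtom P V C} {v : V} :
    v ∈ a.varsOf ↔ FOTerm.var v ∈ a.args := by
  unfold FOAtom.varsOf
  induction a.args with
  | nil => simp
  | cons t l ih => simp [ih, FOTerm.mem_varsOf, eq_comm]

lemma mem_varsFS {S : Finset (FOAtom P V C)} {v : V} :
    v ∈ varsFS S ↔ ∃ a ∈ S, FOTerm.var v ∈ a.args := by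
  simp [varsFS, Finset.mem_sup, FOAtom.mem_varsOf]

lemma Interp.satFS_congr (I : Interp P V C) {a b : V → I.dom} {S : Finset (FOAtom P V C)}
    (hab : ∀ v ∈ varsFS S, a v = b v) (hS : I.satFS a S) : I.satFS b S := by
  intro A hA
  have hmap : A.args.map (I.evalT b) = A.args.map (I.evalT a) := by
    refine List.map_congr_left fun t ht => ?_
    cases t with
    | var v => exact (hab v (mem_varsFS.2 ⟨A, hA, ht⟩)).symm
    | const c => rfl
  simpa only [Interp.satAtom, hmap] using hS A hA

lemma Interp.modelsFB_of_entailsFS (I : Interp P V C) {G Q : Finset (FOAtom P V C)}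
    (hG : I.modelsFB G) (hQ : EntailsFS G Q) : I.modelsFB Q := by
  obtain ⟨a, ha⟩ := hG
  obtain ⟨h, hh⟩ := hQ
  exact ⟨_, I.satFS_of_isHom hh ha⟩

/-- A homomorphism sends the variables of its source to constants or to variables of its
target. -/
lemma IsHom.mem_varsFS_of_eq_var {h : FOSubst V C} {S G : Finset (FOAtom P V C)}
    (hh : IsHom h S G) {v w : V} (hv : v ∈ varsFS S) (hw : h v = FOTerm.var w) :
    w ∈ varsFS G := by
  obtain ⟨A, hA, hvA⟩ := mem_varsFS.1 hv
  exact mem_varsFS.2 ⟨_, hh A hA, List.mem_map.2 ⟨_, hvA, hw⟩⟩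

lemma IsHom.mem_termsFS [DecidableEq C] {h : FOSubst V C} {S G : Finset (FOAtom P V C)}
    (hh : IsHom h S G) {v : V} (hv : v ∈ varsFS S) : h v ∈ termsFS G := by
  obtain ⟨A, hA, hvA⟩ := mem_varsFS.1 hv
  simp only [termsFS, Finset.mem_sup, List.mem_toFinset]
  exact ⟨_, hh A hA, List.mem_map.2 ⟨_, hvA, rfl⟩⟩

lemma TriggerSatisfied.mono {R : DisjRule P V C} {h : FOSubst V C}
    {G G' : Finset (FOAtom P V C)} (hs : TriggerSatisfied R h G) (hG : G ⊆ G') :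
    TriggerSatisfied R h G' := by
  obtain ⟨H, hH, h', h1, h2⟩ := hs
  exact ⟨H, hH, h', h1, h2.mono hG⟩

lemma TriggerSatisfied.congr {R : DisjRule P V C} {h h' : FOSubst V C}
    {G : Finset (FOAtom P V C)} (hs : TriggerSatisfied R h G)
    (heq : ∀ v ∈ varsFS R.body, h' v = h v) : TriggerSatisfied R h' G := by
  obtain ⟨H, hH, g, h1, h2⟩ := hs
  exact ⟨H, hH, g, fun v hv => (h1 v hv).trans (heq v hv).symm, h2⟩

end Basic

/-! ## Trigger applications -/

section Alpha

variable [DecidableEq V]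

lemma exists_isSafeExt [Infinite V] (G : Finset (FOAtom P V C)) (R : DisjRule P V C)
    (H : Finset (FOAtom P V C)) (h : FOSubst V C) : ∃ h', IsSafeExt G R H h h' := by
  let E := varsFS H \ varsFS R.body
  have : Infinite {w : V // w ∉ varsFS G} :=
    ((varsFS G).finite_toSet.infinite_compl).to_subtype
  let fresh : E → {w : V // w ∉ varsFS G} :=
    fun v => Infinite.natEmbedding _ (E.equivFin v)
  have hfresh : Function.Injective fresh := fun v v' hvv => by
    have := (Infinite.natEmbedding _).injective hvv
    exact E.equivFin.injective (Fin.val_injective this)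
  refine ⟨fun v => if hv : v ∈ E then FOTerm.var (fresh ⟨v, hv⟩).1 else h v,
    fun v hv => dif_neg hv, fun v hv => ⟨_, dif_pos hv, (fresh ⟨v, hv⟩).2⟩, ?_⟩
  intro v hv v' hv' heq
  replace heq := (dif_pos (show v ∈ E from hv)).symm.trans
    (heq.trans (dif_pos (show v' ∈ E from hv')))
  rw [FOTerm.var.injEq] at heq
  exact congrArg Subtype.val (hfresh (Subtype.ext heq))

variable [DecidableEq P] [DecidableEq C]

lemma exists_isAlpha [Infinite V] (G : Finset (FOAtom P V C)) (R : DisjRule P V C)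
    (h : FOSubst V C) : ∃ L, IsAlpha G R h L := by
  choose f hf using fun H => exists_isSafeExt G R H h
  refine ⟨R.heads.map fun H => G ∪ applySubFS (f H) H, by simp, fun i hi hi' => ?_⟩
  exact ⟨_, hf _, by simp⟩

lemma IsAlpha.subset {G : Finset (FOAtom P V C)} {R : DisjRule P V C} {h : FOSubst V C}
    {L : List (Finset (FOAtom P V C))} (hL : IsAlpha G R h L) {K : Finset (FOAtom P V C)}
    (hK : K ∈ L) : G ⊆ K := by
  obtain ⟨i, rfl⟩ := List.get_of_mem hK
  obtain ⟨h', -, heq⟩ := hL.2 i i.2 (hL.1 ▸ i.2)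
  exact heq ▸ Finset.subset_union_left

lemma IsAlpha.triggerSatisfied {G : Finset (FOAtom P V C)} {R : DisjRule P V C}
    {h : FOSubst V C} {L : List (Finset (FOAtom P V C))} (hL : IsAlpha G R h L)
    {K : Finset (FOAtom P V C)} (hK : K ∈ L) : TriggerSatisfied R h K := by
  obtain ⟨i, rfl⟩ := List.get_of_mem hK
  obtain ⟨h', hs, heq⟩ := hL.2 i i.2 (hL.1 ▸ i.2)
  refine ⟨_, List.get_mem _ ⟨i, hL.1 ▸ i.2⟩, h', fun v hv => hs.1 v (by simp [hv]), fun A hA => ?_⟩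
  rw [heq]
  exact Finset.mem_union_right _ (Finset.mem_image_of_mem _ hA)

/-- A model of a fact base and of a rule is a model of some element of the result of any
application of the rule. -/
lemma IsAlpha.exists_modelsFB {G : Finset (FOAtom P V C)} {R : DisjRule P V C}
    {h : FOSubst V C} {L : List (Finset (FOAtom P V C))} (hL : IsAlpha G R h L)
    (hh : IsTrigger R h G) (I : Interp P V C) (hG : I.modelsFB G) (hR : I.satRule R) :
    ∃ K ∈ L, I.modelsFB K := by
  obtain ⟨a, ha⟩ := hG
  obtain ⟨H, hH, a', haa', hsat⟩ := hR _ (I.satFS_of_isHom hh ha)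
  obtain ⟨⟨i, hi⟩, rfl⟩ := List.get_of_mem hH
  obtain ⟨h', ⟨hs1, hs2, hs3⟩, heq⟩ := hL.2 i (hL.1 ▸ hi) hi
  refine ⟨_, List.get_mem _ ⟨i, hL.1 ▸ hi⟩, ?_⟩
  rw [heq]
  generalize R.heads.get ⟨i, hi⟩ = H at *
  classical
  let b : V → I.dom := fun w =>
    if hw : ∃ z ∈ varsFS H \ varsFS R.body, h' z = FOTerm.var w then a' hw.choose else a w
  have hb_old : ∀ w ∈ varsFS G, a w = b w := by
    intro w hw
    suffices hnew : ¬ ∃ z ∈ varsFS H \ varsFS R.body, h' z = FOTerm.var w by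
      simp only [b, dif_neg hnew]
    rintro ⟨z, hz, hzw⟩
    obtain ⟨w', hw', hfresh⟩ := hs2 z hz
    rw [hzw, FOTerm.var.injEq] at hw'
    exact hfresh (hw' ▸ hw)
  have hb_new : ∀ v ∈ varsFS H, a' v = I.evalT b (h' v) := by
    intro v hv
    by_cases hvB : v ∈ varsFS R.body
    · rw [haa' v hvB, hs1 v (by simp [hvB])]
      cases hhv : h v with
      | var w => exact hb_old w (hh.mem_varsFS_of_eq_var hvB hhv)
      | const c => rfl
    · have hvE : v ∈ varsFS H \ varsFS R.body := Finset.mem_sdiff.2 ⟨hv, hvB⟩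
      obtain ⟨w, hw, -⟩ := hs2 v hvE
      have hex : ∃ z ∈ varsFS H \ varsFS R.body, h' z = FOTerm.var w := ⟨v, hvE, hw⟩
      have hz := hex.choose_spec
      rw [hw, show I.evalT b (FOTerm.var w) = a' hex.choose from dif_pos hex,
        hs3 _ hz.1 v hvE (hz.2.trans hw.symm)]
  refine ⟨b, fun A hA => ?_⟩
  rcases Finset.mem_union.1 hA with hA | hA
  · exact I.satFS_congr hb_old ha A hA
  · obtain ⟨A, hA', rfl⟩ := Finset.mem_image.1 hA
    exact (I.satAtom_applySub b h' A).2 (I.satFS_congr hb_new hsat A hA')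

end Alpha

/-! ## Finite chase proofs -/

section ChaseProof

variable [DecidableEq P] [DecidableEq V] [DecidableEq C]

/-- `ChaseProves ℛ 𝒬 G`: finitely many rule applications starting from `G` lead to fact
bases all of which entail some CQ of `𝒬`. -/
inductive ChaseProves (ℛ : Set (DisjRule P V C)) (𝒬 : Set (Finset (FOAtom P V C))) :
    Finset (FOAtom P V C) → Prop
  | base (G Q : Finset (FOAtom P V C)) : Q ∈ 𝒬 → EntailsFS G Q → ChaseProves ℛ 𝒬 G
  | step (G : Finset (FOAtom P V C)) (R : DisjRule P V C) (h : FOSubst V C)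
      (L : List (Finset (FOAtom P V C))) : R ∈ ℛ → IsTrigger R h G → IsAlpha G R h L →
      (∀ K ∈ L, ChaseProves ℛ 𝒬 K) → ChaseProves ℛ 𝒬 G

variable {ℛ : Set (DisjRule P V C)} {𝒬 : Set (Finset (FOAtom P V C))}

lemma exists_satisfying_extension_of_finite [Infinite V] {R : DisjRule P V C} (hR : R ∈ ℛ)
    {G : Finset (FOAtom P V C)} (hG : ¬ ChaseProves ℛ 𝒬 G)
    {S : Set (varsFS R.body → FOTerm V C)} (hS : S.Finite) :
    ∃ G', G ⊆ G' ∧ ¬ ChaseProves ℛ 𝒬 G' ∧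
      ∀ h, IsTrigger R h G → (fun v : varsFS R.body => h v) ∈ S →
        TriggerSatisfied R h G' := by
  induction S, hS using Set.Finite.induction_on with
  | empty => exact ⟨G, subset_rfl, hG, by simp⟩
  | @insert f S _ _ ih =>
    obtain ⟨G', hGG', hG', hsat⟩ := ih
    by_cases hf : ∃ h, IsTrigger R h G ∧ (fun v : varsFS R.body => h v) = f
    · obtain ⟨h, hh, rfl⟩ := hf
      obtain ⟨L, hL⟩ := exists_isAlpha G' R h
      obtain ⟨K, hK, hKn⟩ : ∃ K ∈ L, ¬ ChaseProves ℛ 𝒬 K := by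
        by_contra! hcon
        exact hG' (.step G' R h L hR (IsHom.mono hh hGG') hL hcon)
      refine ⟨K, hGG'.trans (hL.subset hK), hKn, fun g hg hgS => ?_⟩
      rcases hgS with hgS | hgS
      · exact (hL.triggerSatisfied hK).congr fun v hv => congrFun hgS ⟨v, hv⟩
      · exact (hsat g hg hgS).mono (hL.subset hK)
    · refine ⟨G', hGG', hG', fun g hg hgS => ?_⟩
      rcases hgS with hgS | hgS
      · exact absurd ⟨g, hg, hgS⟩ hf
      · exact hsat g hg hgS

/-- A fact base without chase proof extends to one without chase proof that satisfies all
triggers on the former. -/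
lemma exists_satisfying_extension [Infinite V] (hfin : ℛ.Finite) {G : Finset (FOAtom P V C)}
    (hG : ¬ ChaseProves ℛ 𝒬 G) :
    ∃ G', G ⊆ G' ∧ ¬ ChaseProves ℛ 𝒬 G' ∧
      ∀ R ∈ ℛ, ∀ h, IsTrigger R h G → TriggerSatisfied R h G' := by
  suffices ∀ S : Set (DisjRule P V C), S.Finite → S ⊆ ℛ → ∃ G', G ⊆ G' ∧
      ¬ ChaseProves ℛ 𝒬 G' ∧ ∀ R ∈ S, ∀ h, IsTrigger R h G → TriggerSatisfied R h G' from
    this ℛ hfin subset_rfl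
  intro S hS
  induction S, hS using Set.Finite.induction_on with
  | empty => exact fun _ => ⟨G, subset_rfl, hG, by simp⟩
  | @insert R S _ _ ih =>
    intro hSub
    obtain ⟨G', hGG', hG', hsat⟩ := ih ((Set.subset_insert R S).trans hSub)
    obtain ⟨K, hK, hKn, hKsat⟩ := exists_satisfying_extension_of_finite
      (hSub (Set.mem_insert R S)) hG'
      (Set.Finite.pi' fun _ : varsFS R.body => (termsFS G).finite_toSet)
    refine ⟨K, hGG'.trans hK, hKn, fun R' hR' h hh => ?_⟩
    rcases hR' with rfl | hR'
    · exact hKsat h (IsHom.mono hh hGG') fun v => IsHom.mem_termsFS hh v.2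
    · exact (hsat R' hR' h hh).mono hK

/-- Completeness of the chase: an entailed UCQ has a finite chase proof. -/
lemma SemEntails.chaseProves [Infinite V] (hfin : ℛ.Finite) {F : Finset (FOAtom P V C)}
    (hF : SemEntails F ℛ 𝒬) : ChaseProves ℛ 𝒬 F := by
  by_contra hn
  choose next hsub hnext hsat using
    fun G : {G // ¬ ChaseProves ℛ 𝒬 G} => exists_satisfying_extension hfin G.2
  let s : ℕ → {G // ¬ ChaseProves ℛ 𝒬 G} :=
    fun n => Nat.rec ⟨F, hn⟩ (fun _ G => ⟨next G, hnext G⟩) n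
  have hmono : Monotone fun n => (s n).1 := monotone_nat_of_le_succ fun n => hsub (s n)
  let I : Interp P V C :=
    { dom := FOTerm V C
      nonempty := ⟨.var (Classical.arbitrary V)⟩
      rel := fun p l => ∃ n, (⟨p, l⟩ : FOAtom P V C) ∈ (s n).1
      cst := .const }
  have heval : ∀ a : FOSubst V C, I.evalT a = FOTerm.applySub a := by
    intro a
    funext t
    cases t <;> rfl
  have hatom : ∀ (a : FOSubst V C) (A : FOAtom P V C),
      I.satAtom a A ↔ ∃ n, A.applySub a ∈ (s n).1 := by
    intro a A
    simp only [Interp.satAtom, heval]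
    rfl
  have hFI : I.modelsFB F := by
    refine ⟨FOTerm.var, fun A hA => (hatom _ A).2 ⟨0, ?_⟩⟩
    have hid : (FOTerm.applySub FOTerm.var : FOTerm V C → FOTerm V C) = id := by
      funext t
      cases t <;> rfl
    simp only [FOAtom.applySub, hid, List.map_id]
    exact hA
  have hRI : ∀ R ∈ ℛ, I.satRule R := by
    intro R hR a ha
    obtain ⟨n, hn⟩ := exists_isHom_of_iUnion hmono fun A hA => (hatom a A).1 (ha A hA)
    obtain ⟨H, hH, h', h1, h2⟩ := hsat (s n) R hR a hn
    exact ⟨H, hH, h', h1, fun A hA => (hatom h' A).2 ⟨n + 1, h2 A hA⟩⟩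
  obtain ⟨Q, hQ, a, ha⟩ := hF I hFI hRI
  obtain ⟨n, hn⟩ := exists_isHom_of_iUnion hmono fun A hA => (hatom a A).1 (ha A hA)
  exact (s n).2 (.base _ Q hQ ⟨a, hn⟩)

end ChaseProof

/-! ## Derivations -/

section Derivation

variable [DecidableEq P] [DecidableEq V] [DecidableEq C]
variable {ℛ : Set (DisjRule P V C)} {𝒬 : Set (Finset (FOAtom P V C))}

lemma ChaseProves.exists_isDerivation_of_mem {G : Finset (FOAtom P V C)}
    (hG : ChaseProves ℛ 𝒬 G) {ℱ₀ : Finset (Finset (FOAtom P V C))}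
    (A : Set (Finset (FOAtom P V C))) (ℱ : Finset (Finset (FOAtom P V C)))
    (hℱ : IsDerivation ℛ ℱ₀ ℱ)
    (hmem : ∀ X ∈ ℱ, X = G ∨ X ∈ A ∨ ∃ Q ∈ 𝒬, EntailsFS X Q) :
    ∃ ℱ', IsDerivation ℛ ℱ₀ ℱ' ∧ ∀ X ∈ ℱ', X ∈ A ∨ ∃ Q ∈ 𝒬, EntailsFS X Q := by
  induction hG generalizing A ℱ with
  | base G Q hQ hGQ =>
    refine ⟨ℱ, hℱ, fun X hX => ?_⟩
    rcases hmem X hX with rfl | hX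
    · exact .inr ⟨Q, hQ, hGQ⟩
    · exact hX
  | step G R h L hR hh hL _ ih =>
    by_cases hGℱ : G ∈ ℱ
    · have hlist : ∀ L' : List (Finset (FOAtom P V C)), L' ⊆ L →
          ∀ ℱ, IsDerivation ℛ ℱ₀ ℱ →
          (∀ X ∈ ℱ, X ∈ L' ∨ X ∈ A ∨ ∃ Q ∈ 𝒬, EntailsFS X Q) →
          ∃ ℱ', IsDerivation ℛ ℱ₀ ℱ' ∧ ∀ X ∈ ℱ', X ∈ A ∨ ∃ Q ∈ 𝒬, EntailsFS X Q := by
        intro L'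
        induction L' with
        | nil => exact fun _ ℱ hℱ hmem => ⟨ℱ, hℱ, fun X hX => by simpa using hmem X hX⟩
        | cons K L' ihL =>
          intro hsub ℱ hℱ hmem
          obtain ⟨ℱ', hℱ', hmem'⟩ := ih K (hsub List.mem_cons_self) ({X | X ∈ L'} ∪ A) ℱ hℱ
            fun X hX => by
              have := hmem X hX
              simp only [List.mem_cons, Set.mem_union, Set.mem_ofPred_eq] at this ⊢
              tauto
          refine ihL (List.subset_of_cons_subset hsub) ℱ' hℱ' fun X hX => ?_
          have := hmem' X hX
          simp only [Set.mem_union, Set.mem_ofPred_eq] at this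
          tauto
      refine hlist L (List.Subset.refl L) _ (.step _ ℱ G R h L hℱ hGℱ hR hh hL) fun X hX => ?_
      rcases Finset.mem_union.1 hX with hX | hX
      · obtain ⟨hne, hX⟩ := Finset.mem_erase.1 hX
        exact .inr ((hmem X hX).resolve_left hne)
      · exact .inl (List.mem_toFinset.1 hX)
    · refine ⟨ℱ, hℱ, fun X hX => (hmem X hX).resolve_left ?_⟩
      rintro rfl
      exact hGℱ hX

lemma ChaseProves.exists_isDerivation {F : Finset (FOAtom P V C)}
    (hF : ChaseProves ℛ 𝒬 F) :
    ∃ ℱk, IsDerivation ℛ {F} ℱk ∧ ∀ G ∈ ℱk, ∃ Q ∈ 𝒬, EntailsFS G Q := by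
  obtain ⟨ℱ, hℱ, hmem⟩ := hF.exists_isDerivation_of_mem ∅ {F} (.refl _)
    fun X hX => .inl (Finset.mem_singleton.1 hX)
  exact ⟨ℱ, hℱ, fun X hX => (hmem X hX).resolve_left (Set.notMem_empty X)⟩

/-- Derivations preserve the property of having an element satisfied by a given model of
the rules. -/
lemma IsDerivation.exists_modelsFB {ℱ₀ ℱ : Finset (Finset (FOAtom P V C))}
    (hℱ : IsDerivation ℛ ℱ₀ ℱ) (I : Interp P V C) (hI : ∀ R ∈ ℛ, I.satRule R)
    (h₀ : ∃ G ∈ ℱ₀, I.modelsFB G) : ∃ G ∈ ℱ, I.modelsFB G := by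
  induction hℱ with
  | refl => exact h₀
  | step ℱ F R h L _ hF hR hh hL ih =>
    obtain ⟨G, hG, hGI⟩ := ih
    by_cases hGF : G = F
    · subst hGF
      obtain ⟨K, hK, hKI⟩ := hL.exists_modelsFB hh I hGI (hI R hR)
      exact ⟨K, Finset.mem_union_right _ (List.mem_toFinset.2 hK), hKI⟩
    · exact ⟨G, Finset.mem_union_left _ (Finset.mem_erase.2 ⟨hGF, hG⟩), hGI⟩

lemma IsDerivation.semEntails {F : Finset (FOAtom P V C)}
    {ℱ : Finset (Finset (FOAtom P V C))} (hℱ : IsDerivation ℛ {F} ℱ)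
    (hQ : ∀ G ∈ ℱ, ∃ Q ∈ 𝒬, EntailsFS G Q) : SemEntails F ℛ 𝒬 := by
  intro I hF hI
  obtain ⟨G, hG, hGI⟩ := hℱ.exists_modelsFB I hI ⟨F, Finset.mem_singleton_self F, hF⟩
  obtain ⟨Q, hQ, hGQ⟩ := hQ G hG
  exact ⟨Q, hQ, I.modelsFB_of_entailsFS hGI hGQ⟩

end Derivation

/-! ## Derivation trees -/

section Tree

variable [DecidableEq P] [DecidableEq V] [DecidableEq C]
variable {ℛ : Set (DisjRule P V C)} {𝒬 : Set (Finset (FOAtom P V C))}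

lemma DerivTree.label_subset_of_mem_children {F : Finset (FOAtom P V C)}
    (T : DerivTree ℛ F) {v w : T.Vtx} (hw : w ∈ T.children v) : T.label v ⊆ T.label w := by
  obtain ⟨R, -, h, -, hL⟩ := T.step v (List.ne_nil_of_mem hw)
  exact hL.subset (List.mem_map_of_mem hw)

lemma DerivTree.IsBranch.monotone_label {F : Finset (FOAtom P V C)} {T : DerivTree ℛ F}
    {b : ℕ → T.Vtx} (hb : T.IsBranch b) : Monotone fun k => T.label (b k) := by
  refine monotone_nat_of_le_succ fun k => ?_
  rcases hb.2 k with hk | ⟨-, hk⟩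
  · exact T.label_subset_of_mem_children hk
  · rw [hk]

/-- A model of the root label and of the rules is a model of all labels along some
branch. -/
lemma DerivTree.exists_isBranch_modelsFB {F : Finset (FOAtom P V C)} (T : DerivTree ℛ F)
    (I : Interp P V C) (hF : I.modelsFB F) (hI : ∀ R ∈ ℛ, I.satRule R) :
    ∃ b, T.IsBranch b ∧ ∀ k, I.modelsFB (T.label (b k)) := by
  have hnext : ∀ v : {v : T.Vtx // I.modelsFB (T.label v)},
      ∃ w : {v : T.Vtx // I.modelsFB (T.label v)},
        w.1 ∈ T.children v.1 ∨ (T.children v.1 = [] ∧ w.1 = v.1) := by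
    intro v
    by_cases hv : T.children v.1 = []
    · exact ⟨v, .inr ⟨hv, rfl⟩⟩
    · obtain ⟨R, hR, h, hh, hL⟩ := T.step v.1 hv
      obtain ⟨K, hK, hKI⟩ := hL.exists_modelsFB hh I v.2 (hI R hR)
      obtain ⟨w, hw, rfl⟩ := List.mem_map.1 hK
      exact ⟨⟨w, hKI⟩, .inl hw⟩
  choose next hspec using hnext
  let b : ℕ → {v : T.Vtx // I.modelsFB (T.label v)} :=
    fun n => Nat.rec ⟨T.root, T.root_label.symm ▸ hF⟩ (fun _ v => next v) n
  exact ⟨fun k => (b k).1, ⟨rfl, fun k => hspec (b k)⟩, fun k => (b k).2⟩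

lemma DerivTree.ResEntails.semEntails {F : Finset (FOAtom P V C)} {T : DerivTree ℛ F}
    (hT : T.ResEntails 𝒬) : SemEntails F ℛ 𝒬 := by
  intro I hF hI
  obtain ⟨b, hb, hbI⟩ := T.exists_isBranch_modelsFB I hF hI
  obtain ⟨Q, hQ, h, hh⟩ := hT b hb
  obtain ⟨n, hn⟩ := exists_isHom_of_iUnion hb.monotone_label fun A hA => by
    simpa using hh A hA
  exact ⟨Q, hQ, I.modelsFB_of_entailsFS (hbI n) ⟨h, hn⟩⟩

/-- The derivation tree with a single vertex. -/
def DerivTree.leaf (ℛ : Set (DisjRule P V C)) (F : Finset (FOAtom P V C)) :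
    DerivTree ℛ F where
  Vtx := Unit
  root := ()
  label _ := F
  children _ := []
  root_label := rfl
  step _ hv := absurd rfl hv

/-- The derivation tree whose root is expanded by a trigger application, with the given
derivation trees grafted below it. -/
def DerivTree.graft {F : Finset (FOAtom P V C)} {R : DisjRule P V C} {h : FOSubst V C}
    {L : List (Finset (FOAtom P V C))} (hR : R ∈ ℛ) (hh : IsTrigger R h F)
    (hL : IsAlpha F R h L) (T : ∀ i : Fin L.length, DerivTree ℛ (L.get i)) :
    DerivTree ℛ F where
  Vtx := Option (Σ i, (T i).Vtx)
  root := none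
  label v := v.elim F fun w => (T w.1).label w.2
  children v := v.elim (List.ofFn fun i => some ⟨i, (T i).root⟩)
    fun w => ((T w.1).children w.2).map fun x => some ⟨w.1, x⟩
  root_label := rfl
  step v hv := by
    rcases v with _ | ⟨i, x⟩
    · refine ⟨R, hR, h, hh, ?_⟩
      have hroots : (fun i => (T i).label (T i).root) = L.get :=
        funext fun i => (T i).root_label
      simpa [List.map_ofFn, Function.comp_def, hroots] using hL
    · obtain ⟨R', hR', h', hh', hL'⟩ := (T i).step x fun hnil => hv (by simp [hnil])
      refine ⟨R', hR', h', hh', ?_⟩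
      simpa [Function.comp_def] using hL'

lemma DerivTree.graft_resEntails {F : Finset (FOAtom P V C)} {R : DisjRule P V C}
    {h : FOSubst V C} {L : List (Finset (FOAtom P V C))} (hR : R ∈ ℛ)
    (hh : IsTrigger R h F) (hL : IsAlpha F R h L)
    (T : ∀ i : Fin L.length, DerivTree ℛ (L.get i)) (hLne : L ≠ [])
    (hT : ∀ i, (T i).ResEntails 𝒬) : (DerivTree.graft hR hh hL T).ResEntails 𝒬 := by
  rintro b ⟨hb0, hb⟩
  obtain ⟨i, hi⟩ : ∃ i, b 1 = some ⟨i, (T i).root⟩ := by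
    have h0 := hb 0
    rw [hb0] at h0
    rcases h0 with h0 | ⟨h0, -⟩
    · obtain ⟨i, hi⟩ := (List.mem_ofFn' _ _).1 h0
      exact ⟨i, hi.symm⟩
    · exact absurd (List.ofFn_eq_nil_iff.1 h0) fun hlen => hLne (List.length_eq_zero_iff.1 hlen)
  have hsucc : ∀ (k : ℕ) (x : (T i).Vtx), b (k + 1) = some ⟨i, x⟩ →
      ∃ y, b (k + 2) = some ⟨i, y⟩ ∧
        (y ∈ (T i).children x ∨ ((T i).children x = [] ∧ y = x)) := by
    intro k x hx
    have hk := hb (k + 1)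
    rw [hx] at hk
    rcases hk with hk | ⟨hk, hk'⟩
    · obtain ⟨y, hy, hyb⟩ := List.mem_map.1 hk
      exact ⟨y, hyb.symm, .inl hy⟩
    · exact ⟨x, hk', .inr ⟨List.map_eq_nil_iff.1 hk, rfl⟩⟩
  have hstay : ∀ k, ∃ x, b (k + 1) = some ⟨i, x⟩ := by
    intro k
    induction k with
    | zero => exact ⟨_, hi⟩
    | succ k ih =>
      obtain ⟨x, hx⟩ := ih
      obtain ⟨y, hy, -⟩ := hsucc k x hx
      exact ⟨y, hy⟩
  choose c hc using hstay
  have hinj : ∀ {x y : (T i).Vtx},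
      (some ⟨i, x⟩ : Option (Σ i, (T i).Vtx)) = some ⟨i, y⟩ → x = y := fun hxy =>
    eq_of_heq (Sigma.mk.inj (Option.some.inj hxy)).2
  have hcb : (T i).IsBranch c := by
    refine ⟨hinj ((hc 0).symm.trans hi), fun k => ?_⟩
    obtain ⟨y, hy, hyc⟩ := hsucc k (c k) (hc k)
    rwa [hinj ((hc (k + 1)).symm.trans hy)]
  obtain ⟨Q, hQ, g, hg⟩ := hT i c hcb
  refine ⟨Q, hQ, g, fun A hA => ?_⟩
  obtain ⟨k, hk⟩ := Set.mem_iUnion.1 (hg A hA)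
  refine Set.mem_iUnion.2 ⟨k + 1, ?_⟩
  rw [hc k]
  exact hk

lemma ChaseProves.exists_derivTree (hWF : ∀ R ∈ ℛ, R.WF) {F : Finset (FOAtom P V C)}
    (hF : ChaseProves ℛ 𝒬 F) :
    ∃ T : DerivTree ℛ F, Finite T.Vtx ∧ T.ResEntails 𝒬 := by
  induction hF with
  | base G Q hQ hGQ =>
    obtain ⟨h, hh⟩ := hGQ
    exact ⟨DerivTree.leaf ℛ G, inferInstanceAs (Finite Unit),
      fun b _ => ⟨Q, hQ, h, fun A hA => Set.mem_iUnion.2 ⟨0, hh A hA⟩⟩⟩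
  | step G R h L hR hh hL _ ih =>
    choose T hTfin hT using fun i : Fin L.length => ih (L.get i) (List.get_mem _ _)
    have hLne : L ≠ [] := fun hnil =>
      (hWF R hR).2.1 (List.length_eq_zero_iff.1 (by rw [← hL.1, hnil, List.length_nil]))
    exact ⟨DerivTree.graft hR hh hL T, inferInstanceAs (Finite (Option (Σ i, (T i).Vtx))),
      DerivTree.graft_resEntails hR hh hL T hLne hT⟩

end Tree

/-- `F, ℛ ⊨ 𝒬` iff there is a finite derivation tree `𝒯` of `(F, ℛ)`
with `res(𝒯) ⊨ 𝒬`; equivalently, iff there is a derivation of `({F}, ℛ)` whose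
result entails `𝒬`. -/
theorem stmt13 {P V C : Type} [DecidableEq P] [DecidableEq V] [DecidableEq C] [Infinite V]
    (ℛ : Set (DisjRule P V C)) (hfin : ℛ.Finite) (hWF : ∀ R ∈ ℛ, R.WF)
    (F : Finset (FOAtom P V C)) (𝒬 : Finset (Finset (FOAtom P V C))) :
    (SemEntails F ℛ (↑𝒬 : Set (Finset (FOAtom P V C))) ↔
      ∃ T : DerivTree ℛ F, Finite T.Vtx ∧
        T.ResEntails (↑𝒬 : Set (Finset (FOAtom P V C)))) ∧
    (SemEntails F ℛ (↑𝒬 : Set (Finset (FOAtom P V C))) ↔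
      ∃ ℱk : Finset (Finset (FOAtom P V C)),
        IsDerivation ℛ {F} ℱk ∧ ∀ G ∈ ℱk, ∃ Q ∈ 𝒬, EntailsFS G Q) := by
  refine ⟨⟨fun hF => (hF.chaseProves hfin).exists_derivTree hWF, ?_⟩,
    ⟨fun hF => (hF.chaseProves hfin).exists_isDerivation, ?_⟩⟩
  · rintro ⟨T, -, hT⟩
    exact hT.semEntails
  · rintro ⟨ℱk, hℱk, hQ⟩
    exact hℱk.semEntails hQ
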